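/- arXiv:2601.03318 — 2 statements merged into one kernel-verified Lean document; each statement's English description precedes it below -/
import Mathlib

section
/- Let 0 < α ≤ 1 and μ > 0. Then E_{α,1}(−μ t^α) → 0 as t → ∞, where E_{α,1}(z) = ∑_{k=0}^∞ z^k/Γ(αk+1). Consequently, for any u₀, c ∈ ℝ, the function u(t) = (u₀ − c)·E_{α,1}(−μ t^α) + c converges to c, the minimizer of f(u) = (u − c)², as t → ∞. -/
/-- The two-parameter Mittag-Leffler function `E_{α,β}(z) = ∑ₖ z^k / Γ(α k + β)`. -/
noncomputable def mittagLeffler (α β z : ℝ) : ℝ :=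
  ∑' k : ℕ, z ^ k / Real.Gamma (α * k + β)

open Filter Topology

namespace MittagLeffler

/-- The finite product `∏_{j=1}^n (j + α s) / (j + s)`, which after multiplication by
`n ^ ((1 - α) s)` converges to `Γ(1 + s) / Γ(1 + α s)`. -/
noncomputable def gammaRatio (α s : ℝ) (n : ℕ) : ℝ :=
  ∏ j ∈ Finset.range n, ((j : ℝ) + 1 + α * s) / ((j : ℝ) + 1 + s)

lemma gammaRatio_succ (α s : ℝ) (n : ℕ) :
    gammaRatio α s (n + 1) =
      gammaRatio α s n * (((n : ℝ) + 1 + α * s) / ((n : ℝ) + 1 + s)) :=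
  Finset.prod_range_succ _ _

lemma mul_gammaSeq (s : ℝ) (hs : s ≠ 0) (n : ℕ) :
    s * Real.GammaSeq s n =
      (n : ℝ) ^ s * n.factorial / ∏ j ∈ Finset.range n, ((j : ℝ) + 1 + s) := by
  rw [Real.GammaSeq, Finset.prod_range_succ']
  have : ∏ j ∈ Finset.range n, (s + ((j + 1 : ℕ) : ℝ)) =
      ∏ j ∈ Finset.range n, ((j : ℝ) + 1 + s) :=
    Finset.prod_congr rfl fun j _ => by push_cast; ring
  rw [this, Nat.cast_zero, add_zero, mul_comm _ s, ← mul_div_assoc, mul_div_mul_left _ _ hs]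

/-- Euler's limit formula for the quotient `Γ(s + 1) / Γ(α s + 1)`. -/
lemma tendsto_rpow_mul_gammaRatio {α s : ℝ} (hα0 : 0 < α) (hα1 : α ≤ 1) (hs : -1 < s) :
    Tendsto (fun n : ℕ => (n : ℝ) ^ ((1 - α) * s) * gammaRatio α s n) atTop
      (𝓝 (Real.Gamma (s + 1) / Real.Gamma (α * s + 1))) := by
  rcases eq_or_ne s 0 with rfl | hs0
  · have (n : ℕ) : gammaRatio α 0 n = 1 := by
      refine Finset.prod_eq_one fun j _ => ?_
      rw [mul_zero, add_zero, div_self (by positivity)]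
    simp [this]
  have hαs : α * s ≠ 0 := mul_ne_zero hα0.ne' hs0
  have hαs1 : 0 < α * s + 1 := by nlinarith
  rw [Real.Gamma_add_one hs0, Real.Gamma_add_one hαs]
  have hne : α * s * Real.Gamma (α * s) ≠ 0 := by
    rw [← Real.Gamma_add_one hαs]
    exact (Real.Gamma_pos_of_pos hαs1).ne'
  refine (((Real.GammaSeq_tendsto_Gamma s).const_mul s).div
    ((Real.GammaSeq_tendsto_Gamma (α * s)).const_mul (α * s)) hne).congr' ?_
  filter_upwards [eventually_gt_atTop 0] with n hn
  have hn' : (0 : ℝ) < n := by exact_mod_cast hn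
  simp only [Pi.div_apply]
  rw [mul_gammaSeq s hs0, mul_gammaSeq _ hαs, gammaRatio, Finset.prod_div_distrib,
    show (1 - α) * s = s - α * s by ring, Real.rpow_sub hn']
  have h1 : ∏ j ∈ Finset.range n, ((j : ℝ) + 1 + s) ≠ 0 :=
    Finset.prod_ne_zero_iff.2 fun j _ => by
      have : (0 : ℝ) ≤ j := j.cast_nonneg
      linarith
  have h2 : ∏ j ∈ Finset.range n, ((j : ℝ) + 1 + α * s) ≠ 0 :=
    Finset.prod_ne_zero_iff.2 fun j _ => by
      have : (0 : ℝ) ≤ j := j.cast_nonneg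
      linarith
  have h3 : (n : ℝ) ^ (α * s) ≠ 0 := (Real.rpow_pos_of_pos hn' _).ne'
  have h4 : (n.factorial : ℝ) ≠ 0 := by positivity
  field_simp

lemma gammaRatio_nonneg {α s : ℝ} (hα0 : 0 < α) (hs : 0 ≤ s) (n : ℕ) :
    0 ≤ gammaRatio α s n :=
  Finset.prod_nonneg fun j _ => by positivity

lemma gammaRatio_le_one {α s : ℝ} (hα0 : 0 < α) (hα1 : α ≤ 1) (hs : 0 ≤ s) (n : ℕ) :
    gammaRatio α s n ≤ 1 := by
  refine Finset.prod_le_one (fun j _ => by positivity) fun j _ => ?_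
  rw [div_le_one (by positivity)]
  nlinarith

lemma rpow_mul_gammaRatio_le_succ {α : ℝ} (hα0 : 0 < α) (hα1 : α ≤ 1) (k : ℕ) {n : ℕ}
    (hn : 0 < n) :
    (n : ℝ) ^ ((1 - α) * k) * gammaRatio α k n ≤
      ((n + 1 : ℕ) : ℝ) ^ ((1 - α) * k) * gammaRatio α k (n + 1) := by
  have hn' : (0 : ℝ) < n := by exact_mod_cast hn
  have hk : (0 : ℝ) ≤ k := k.cast_nonneg
  have hb : 0 ≤ 1 - α := by linarith
  set N : ℝ := (n : ℝ) + 1 with hN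
  have hN0 : 0 < N := by positivity
  have amgm : (N + k) ^ α * N ^ (1 - α) ≤ N + α * k := by
    have := Real.geom_mean_le_arith_mean2_weighted hα0.le hb
      (show 0 ≤ N + k by positivity) hN0.le (by ring)
    linarith
  have bern : N + k ≤ N * (N / n) ^ k := by
    have h1 : 1 + (k : ℝ) * (1 / n) ≤ (1 + 1 / n) ^ k :=
      one_add_mul_le_pow ((by norm_num : (-2 : ℝ) ≤ 0).trans (by positivity)) k
    have h2 : N / n = 1 + 1 / n := by rw [hN]; field_simp
    rw [h2]
    calc N + k ≤ N * (1 + (k : ℝ) * (1 / n)) := by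
          have : (k : ℝ) ≤ N * (k * (1 / n)) := by
            rw [show N * (k * (1 / (n : ℝ))) = k + k / n by rw [hN]; field_simp]
            have : 0 ≤ (k : ℝ) / n := by positivity
            linarith
          linarith
      _ ≤ _ := by gcongr
  have key : (n : ℝ) ^ ((1 - α) * k) ≤ N ^ ((1 - α) * k) * ((N + α * k) / (N + k)) := by
    have hNk : 0 < N + k := by positivity
    rw [← mul_div_assoc, le_div_iff₀ hNk]
    have e1 : (N / n) ^ ((1 - α) * k) = N ^ ((1 - α) * k) / (n : ℝ) ^ ((1 - α) * k) :=
      Real.div_rpow hN0.le hn'.le _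
    have e2 : ((N / n) ^ k) ^ (1 - α) = (N / n) ^ ((1 - α) * k) := by
      rw [mul_comm, Real.rpow_mul (by positivity), Real.rpow_natCast]
    have hnp : 0 < (n : ℝ) ^ ((1 - α) * k) := Real.rpow_pos_of_pos hn' _
    calc (n : ℝ) ^ ((1 - α) * k) * (N + k)
        = (n : ℝ) ^ ((1 - α) * k) * ((N + k) ^ α * (N + k) ^ (1 - α)) := by
          rw [← Real.rpow_add hNk]; simp
      _ ≤ (n : ℝ) ^ ((1 - α) * k) * ((N + k) ^ α * (N * (N / n) ^ k) ^ (1 - α)) := by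
          gcongr
      _ = N ^ ((1 - α) * k) * ((N + k) ^ α * N ^ (1 - α)) := by
          rw [Real.mul_rpow hN0.le (by positivity), e2, e1]
          field_simp
      _ ≤ N ^ ((1 - α) * k) * (N + α * k) := by gcongr
  rw [gammaRatio_succ, ← hN, show ((n + 1 : ℕ) : ℝ) = N by push_cast; rfl]
  calc _ ≤ N ^ ((1 - α) * k) * ((N + α * k) / (N + k)) * gammaRatio α k n :=
        mul_le_mul_of_nonneg_right key (gammaRatio_nonneg hα0 hk n)
    _ = _ := by ring

lemma rpow_mul_gammaRatio_le {α : ℝ} (hα0 : 0 < α) (hα1 : α ≤ 1) (k : ℕ) {n : ℕ}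
    (hn : 0 < n) :
    (n : ℝ) ^ ((1 - α) * k) * gammaRatio α k n ≤ k.factorial / Real.Gamma (α * k + 1) := by
  have hk : (-1 : ℝ) < k := by linarith [k.cast_nonneg (α := ℝ)]
  have h := tendsto_rpow_mul_gammaRatio hα0 hα1 hk
  rw [Real.Gamma_nat_eq_factorial] at h
  refine ge_of_tendsto h ?_
  filter_upwards [eventually_ge_atTop n] with m hm
  induction m, hm using Nat.le_induction with
  | base => exact le_rfl
  | succ m hm ih => exact ih.trans (rpow_mul_gammaRatio_le_succ hα0 hα1 k (hn.trans_le hm))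

/-- Termwise integration of a power series against the density `(n + 1) v ^ n` on `[0, 1]`. -/
lemma hasSum_integral_pow {c : ℕ → ℝ} (hc : Summable c) (n : ℕ) :
    HasSum (fun k : ℕ => c k * (((n : ℝ) + 1) / ((n : ℝ) + 1 + k)))
      (∫ v in (0 : ℝ)..1, ((n : ℝ) + 1) * v ^ n * ∑' k : ℕ, c k * v ^ k) := by
  have hterm (k : ℕ) : ∫ v in (0 : ℝ)..1, ((n : ℝ) + 1) * v ^ n * (c k * v ^ k) =
      c k * (((n : ℝ) + 1) / ((n : ℝ) + 1 + k)) := by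
    have : ∀ v : ℝ, ((n : ℝ) + 1) * v ^ n * (c k * v ^ k) =
        (((n : ℝ) + 1) * c k) * v ^ (n + k) := fun v => by ring
    simp only [this, intervalIntegral.integral_const_mul, integral_pow]
    push_cast
    simp only [one_pow, ne_eq, Nat.add_eq_zero_iff, one_ne_zero, and_false, not_false_eq_true,
      zero_pow, sub_zero]
    rw [show (n : ℝ) + k + 1 = n + 1 + k by ring]
    ring
  simp only [← hterm]
  have hsum {v : ℝ} (hv : v ∈ Set.uIoc (0 : ℝ) 1) : Summable fun k => c k * v ^ k := by
    rw [Set.uIoc_of_le zero_le_one] at hv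
    refine Summable.of_norm_bounded hc.norm fun k => ?_
    rw [norm_mul, norm_pow, Real.norm_of_nonneg hv.1.le]
    exact mul_le_of_le_one_right (norm_nonneg _) (pow_le_one₀ hv.1.le hv.2)
  refine intervalIntegral.hasSum_integral_of_dominated_convergence
    (fun k _ => ((n : ℝ) + 1) * ‖c k‖) (fun k => ?_) (fun k => ?_) ?_ ?_ ?_
  · exact (by fun_prop : Continuous fun v : ℝ =>
      ((n : ℝ) + 1) * v ^ n * (c k * v ^ k)).aestronglyMeasurable
  · refine Eventually.of_forall fun v hv => ?_
    rw [Set.uIoc_of_le zero_le_one] at hv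
    rw [norm_mul, norm_mul, norm_mul, norm_pow, norm_pow, Real.norm_of_nonneg hv.1.le,
      Real.norm_of_nonneg (by positivity : 0 ≤ (n : ℝ) + 1)]
    have h1 : v ^ n ≤ 1 := pow_le_one₀ hv.1.le hv.2
    have h2 : v ^ k ≤ 1 := pow_le_one₀ hv.1.le hv.2
    have h3 : 0 ≤ v ^ k := pow_nonneg hv.1.le _
    gcongr
    · exact mul_le_of_le_one_right (by positivity) h1
    · exact mul_le_of_le_one_right (norm_nonneg _) h2
  · exact Eventually.of_forall fun v _ => hc.norm.mul_left _
  · simp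
  · exact Eventually.of_forall fun v hv => (hsum hv).hasSum.mul_left _

lemma abs_integral_pow_mul_le {g : ℝ → ℝ} {C : ℝ} (n : ℕ)
    (hg : ∀ v, 0 < v → |g v| ≤ C * v ^ (-(1 / 2) : ℝ)) :
    |∫ v in (0 : ℝ)..1, ((n : ℝ) + 1) * v ^ n * g v| ≤
      C * (((n : ℝ) + 1) / ((n : ℝ) + 1 + -(1 / 2))) := by
  have hn : (0 : ℝ) ≤ n := n.cast_nonneg
  have hr : (-1 : ℝ) < n + -(1 / 2) := by linarith
  have hval : ∫ v in (0 : ℝ)..1, (((n : ℝ) + 1) * C) * v ^ ((n : ℝ) + -(1 / 2)) =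
      C * (((n : ℝ) + 1) / ((n : ℝ) + 1 + -(1 / 2))) := by
    rw [intervalIntegral.integral_const_mul, integral_rpow (Or.inl hr), Real.one_rpow,
      Real.zero_rpow (by linarith), show (n : ℝ) + -(1 / 2) + 1 = n + 1 + -(1 / 2) by ring]
    ring
  rw [← hval, ← Real.norm_eq_abs]
  refine intervalIntegral.norm_integral_le_of_norm_le zero_le_one
    (Eventually.of_forall fun v hv => ?_)
    ((intervalIntegral.intervalIntegrable_rpow' hr).const_mul _)
  rw [norm_mul, Real.norm_of_nonneg (mul_nonneg (by positivity) (pow_nonneg hv.1.le _)),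
    Real.rpow_add hv.1, Real.rpow_natCast, Real.norm_eq_abs]
  calc ((n : ℝ) + 1) * v ^ n * |g v|
      ≤ ((n : ℝ) + 1) * v ^ n * (C * v ^ (-(1 / 2) : ℝ)) :=
        mul_le_mul_of_nonneg_left (hg v hv.1) (mul_nonneg (by positivity) (pow_nonneg hv.1.le _))
    _ = _ := by ring

lemma summable_gammaRatio {α : ℝ} (hα0 : 0 < α) (hα1 : α ≤ 1) (n : ℕ) (x : ℝ) :
    Summable fun k : ℕ => x ^ k / k.factorial * gammaRatio α k n := by
  refine Summable.of_norm_bounded (Real.summable_pow_div_factorial x).norm fun k => ?_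
  rw [norm_mul, Real.norm_of_nonneg (gammaRatio_nonneg hα0 k.cast_nonneg n)]
  exact mul_le_of_le_one_right (norm_nonneg _) (gammaRatio_le_one hα0 hα1 k.cast_nonneg n)

lemma abs_tsum_gammaRatio_le {α : ℝ} (hα0 : 0 < α) (hα1 : α ≤ 1) (n : ℕ) {x : ℝ}
    (hx : 0 < x) :
    |∑' k : ℕ, (-x) ^ k / k.factorial * gammaRatio α k n| ≤
      gammaRatio α (-(1 / 2)) n * x ^ (-(1 / 2) : ℝ) := by
  induction n generalizing x with
  | zero =>
    simp only [gammaRatio, Finset.range_zero, Finset.prod_empty, mul_one, one_mul]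
    have h := congrFun (NormedSpace.exp_eq_tsum_div (𝔸 := ℝ)) (-x)
    rw [← h, ← Real.exp_eq_exp_ℝ, abs_of_pos (Real.exp_pos _), Real.exp_neg,
      Real.rpow_neg hx.le, ← Real.sqrt_eq_rpow]
    refine inv_anti₀ (Real.sqrt_pos.2 hx) ?_
    have h1 := Real.add_one_le_exp x
    have h2 := Real.sq_sqrt hx.le
    nlinarith [sq_nonneg (√x - 1)]
  | succ n ih =>
    set c : ℕ → ℝ := fun k => (-x) ^ k / k.factorial * gammaRatio α k n with hc
    have hcs : Summable c := summable_gammaRatio hα0 hα1 n (-x)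
    have hsum := (hcs.hasSum.mul_left α).add ((hasSum_integral_pow hcs n).mul_left (1 - α))
    have hterm (k : ℕ) : (-x) ^ k / k.factorial * gammaRatio α k (n + 1) =
        α * c k + (1 - α) * (c k * (((n : ℝ) + 1) / ((n : ℝ) + 1 + k))) := by
      have : (n : ℝ) + 1 + k ≠ 0 := by positivity
      rw [gammaRatio_succ, hc]
      field_simp
      ring
    simp only [hterm]
    rw [hsum.tsum_eq]
    have hint := abs_integral_pow_mul_le (g := fun v => ∑' k : ℕ, c k * v ^ k)
      (C := gammaRatio α (-(1 / 2)) n * x ^ (-(1 / 2) : ℝ)) n (fun v hv => by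
        have := ih (mul_pos hx hv)
        rw [Real.mul_rpow hx.le hv.le, ← mul_assoc] at this
        convert this using 4 with k
        rw [hc, ← neg_mul, mul_pow]
        ring)
    have hn : (0 : ℝ) ≤ n := n.cast_nonneg
    have hne : (n : ℝ) + 1 + -(1 / 2) ≠ 0 := by linarith
    have hb : 0 ≤ 1 - α := by linarith
    have h0 := ih hx
    calc _ ≤ |α * ∑' k, c k| + |(1 - α) * _| := abs_add_le _ _
      _ = α * |∑' k, c k| + (1 - α) * |_| := by
        rw [abs_mul, abs_mul, abs_of_pos hα0, abs_of_nonneg hb]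
      _ ≤ α * (gammaRatio α (-(1 / 2)) n * x ^ (-(1 / 2) : ℝ)) + (1 - α) * _ :=
        add_le_add (mul_le_mul_of_nonneg_left h0 hα0.le) (mul_le_mul_of_nonneg_left hint hb)
      _ = _ := by
        have hdiv : ((n : ℝ) + 1 + α * -(1 / 2)) / ((n : ℝ) + 1 + -(1 / 2)) =
            α + (1 - α) * (((n : ℝ) + 1) / ((n : ℝ) + 1 + -(1 / 2))) := by
          rw [div_eq_iff hne, add_mul, mul_assoc, div_mul_cancel₀ _ hne]
          ring
        rw [gammaRatio_succ, hdiv]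
        ring

/-- The Mittag-Leffler function decays at least as fast as `x ^ (-1/2)` along the negative axis. -/
lemma abs_mittagLeffler_neg_le {α : ℝ} (hα0 : 0 < α) (hα1 : α ≤ 1) {x : ℝ} (hx : 0 < x) :
    |mittagLeffler α 1 (-x)| ≤
      Real.Gamma (-(1 / 2) + 1) / Real.Gamma (α * -(1 / 2) + 1) * x ^ (-(1 / 2) : ℝ) := by
  by_cases hsum : Summable fun k : ℕ => (-x) ^ k / Real.Gamma (α * k + 1)
  swap
  · rw [mittagLeffler, tsum_eq_zero_of_not_summable hsum, abs_zero]
    have h1 : 0 < Real.Gamma (-(1 / 2) + 1) := Real.Gamma_pos_of_pos (by norm_num)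
    have h2 : 0 < Real.Gamma (α * -(1 / 2) + 1) := Real.Gamma_pos_of_pos (by linarith)
    positivity
  have hterm (n k : ℕ) :
      (-((n : ℝ) ^ (1 - α) * x)) ^ k / k.factorial * gammaRatio α k n =
        (-x) ^ k / k.factorial * ((n : ℝ) ^ ((1 - α) * k) * gammaRatio α k n) := by
    rw [Real.rpow_mul n.cast_nonneg, Real.rpow_natCast, ← mul_neg, mul_pow]
    ring
  have hlim : Tendsto (fun n : ℕ => ∑' k : ℕ,
      (-((n : ℝ) ^ (1 - α) * x)) ^ k / k.factorial * gammaRatio α k n) atTop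
      (𝓝 (mittagLeffler α 1 (-x))) := by
    simp only [hterm]
    refine tendsto_tsum_of_dominated_convergence hsum.norm (fun k => ?_) ?_
    · have hk : (-1 : ℝ) < k := by linarith [k.cast_nonneg (α := ℝ)]
      have h := (tendsto_rpow_mul_gammaRatio hα0 hα1 hk).const_mul ((-x) ^ k / k.factorial)
      rw [Real.Gamma_nat_eq_factorial] at h
      convert h using 2
      have : (k.factorial : ℝ) ≠ 0 := by positivity
      field_simp
    · filter_upwards [eventually_gt_atTop 0] with n hn k
      have hG : 0 < Real.Gamma (α * k + 1) := Real.Gamma_pos_of_pos (by positivity)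
      have hk : (k.factorial : ℝ) ≠ 0 := by positivity
      rw [norm_mul, norm_div, norm_div, Real.norm_of_nonneg hG.le, Real.norm_natCast,
        Real.norm_of_nonneg (mul_nonneg (Real.rpow_nonneg n.cast_nonneg _)
          (gammaRatio_nonneg hα0 k.cast_nonneg n))]
      calc _ ≤ ‖(-x) ^ k‖ / k.factorial * (k.factorial / Real.Gamma (α * k + 1)) := by
            gcongr
            exact rpow_mul_gammaRatio_le hα0 hα1 k hn
        _ = _ := by field_simp
  refine le_of_tendsto_of_tendsto hlim.abs
    ((tendsto_rpow_mul_gammaRatio (s := -(1 / 2)) hα0 hα1 (by norm_num)).mul_const _) ?_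
  filter_upwards [eventually_gt_atTop 0] with n hn
  have hn' : (0 : ℝ) < n := by exact_mod_cast hn
  have hp : 0 < (n : ℝ) ^ (1 - α) := Real.rpow_pos_of_pos hn' _
  refine (abs_tsum_gammaRatio_le hα0 hα1 n (mul_pos hp hx)).trans_eq ?_
  rw [Real.mul_rpow hp.le hx.le, ← Real.rpow_mul hn'.le]
  ring

lemma tendsto_mittagLeffler_neg_atTop {α : ℝ} (hα0 : 0 < α) (hα1 : α ≤ 1) :
    Tendsto (fun x : ℝ => mittagLeffler α 1 (-x)) atTop (𝓝 0) := by
  refine squeeze_zero_norm' ?_ (by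
    simpa using (tendsto_rpow_neg_atTop (by norm_num : (0 : ℝ) < 1 / 2)).const_mul
      (Real.Gamma (-(1 / 2) + 1) / Real.Gamma (α * -(1 / 2) + 1)))
  filter_upwards [eventually_gt_atTop 0] with x hx
  simpa using abs_mittagLeffler_neg_le hα0 hα1 hx

end MittagLeffler

/-- For `0 < α ≤ 1` and `μ > 0`, `E_{α,1}(-μ t^α) → 0` as `t → ∞`; consequently
`u t = (u₀ - c) E_{α,1}(-μ t^α) + c` converges to the minimizer `c` of `f u = (u - c)²`. -/
theorem mittagLeffler_tendsto_zero (α μ : ℝ) (hα0 : 0 < α) (hα1 : α ≤ 1) (hμ : 0 < μ) :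
    Filter.Tendsto (fun t : ℝ => mittagLeffler α 1 (-μ * t ^ α))
      Filter.atTop (nhds 0) ∧
    ∀ u₀ c : ℝ,
      Filter.Tendsto (fun t : ℝ => (u₀ - c) * mittagLeffler α 1 (-μ * t ^ α) + c)
        Filter.atTop (nhds c) := by
  have h : Tendsto (fun t : ℝ => mittagLeffler α 1 (-μ * t ^ α)) atTop (𝓝 0) := by
    simpa only [Function.comp_def, neg_mul] using
      (MittagLeffler.tendsto_mittagLeffler_neg_atTop hα0 hα1).comp
        ((tendsto_rpow_atTop hα0).const_mul_atTop hμ)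
  exact ⟨h, fun u₀ c => by simpa using (h.const_mul (u₀ - c)).add_const c⟩
end

section
/- Let 1 < α < 2, μ > 0, c ∈ ℝ, u₀ ∈ ℝ, and u₁ ∈ ℝ. Define u(t) = (u₀ − c)·E_{α,1}(−μ t^α) + c + u₁·t·E_{α,2}(−μ t^α) for t ≥ 0, where E_{α,β}(z) = ∑_{k=0}^∞ z^k/Γ(αk+β). Then u(0) = u₀, u′(0) = u₁, u is twice differentiable on (0,∞), and for every t > 0 the Caputo fractional derivative of u of order α satisfies (1/Γ(2−α)) ∫₀ᵗ u″(s)(t − s)^(1−α) ds = −μ·(u(t) − c). -/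
section

open Filter Topology MeasureTheory Set

theorem summable_pow_div_Gamma {α : ℝ} (hα : 1 < α) (β z : ℝ) :
    Summable fun k : ℕ ↦ z ^ k / Real.Gamma (α * k + β) := by
  refine Summable.of_norm_bounded_eventually_nat (Real.summable_pow_div_factorial |z|) ?_
  have hlarge : ∀ᶠ k : ℕ in atTop, (2 - β) / (α - 1) ≤ k :=
    tendsto_natCast_atTop_atTop.eventually_ge_atTop _
  filter_upwards [hlarge, eventually_ge_atTop 1] with k hk hk1
  have hk1' : (1 : ℝ) ≤ k := by exact_mod_cast hk1
  rw [div_le_iff₀ (by linarith)] at hk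
  have hGamma : (k.factorial : ℝ) ≤ Real.Gamma (α * k + β) := by
    rw [← Real.Gamma_nat_eq_factorial]
    refine Real.Gamma_strictMonoOn_Ici.monotoneOn ?_ ?_ ?_ <;> (try simp only [mem_Ici]) <;> linarith
  have hfact : (0 : ℝ) < k.factorial := by positivity
  rw [norm_div, norm_pow, Real.norm_eq_abs, Real.norm_eq_abs, abs_of_pos (hfact.trans_le hGamma)]
  gcongr

theorem continuous_mittagLeffler {α β : ℝ} (hα : 1 < α) : Continuous (mittagLeffler α β) := by
  refine continuous_iff_continuousAt.2 fun z ↦ ?_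
  have hz : Metric.ball (0 : ℝ) (|z| + 1) ∈ 𝓝 z :=
    Metric.isOpen_ball.mem_nhds (by simp)
  refine ContinuousOn.continuousAt (s := Metric.ball 0 (|z| + 1)) ?_ hz
  refine continuousOn_tsum (fun k ↦ by fun_prop)
    (summable_pow_div_Gamma hα β (|z| + 1)).norm fun k x hx ↦ ?_
  rw [mem_ball_zero_iff, Real.norm_eq_abs] at hx
  rw [norm_div, norm_div, norm_pow, norm_pow, Real.norm_eq_abs,
    Real.norm_of_nonneg (by positivity : 0 ≤ |z| + 1)]
  gcongr

theorem mittagLeffler_one_zero (α : ℝ) : mittagLeffler α 1 0 = 1 := by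
  rw [mittagLeffler, tsum_eq_single 0 (fun k hk ↦ by simp [hk])]
  simp

/-- The kernel `t ^ (β - 1) * E_{α,β}(r t ^ α)`, expanded as a series of powers of `t`. -/
noncomputable def mittagLefflerKernel (α r β t : ℝ) : ℝ :=
  ∑' k : ℕ, r ^ k * t ^ (α * k + β - 1) / Real.Gamma (α * k + β)

theorem mittagLefflerKernel_term_eq {t : ℝ} (ht : 0 < t) (α r β : ℝ) (k : ℕ) :
    r ^ k * t ^ (α * k + β - 1) / Real.Gamma (α * k + β)
      = t ^ (β - 1) * ((r * t ^ α) ^ k / Real.Gamma (α * k + β)) := by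
  rw [add_sub_assoc, Real.rpow_add ht, Real.rpow_mul ht.le, Real.rpow_natCast, mul_pow]
  ring

theorem mittagLefflerKernel_eq {t : ℝ} (ht : 0 < t) (α r β : ℝ) :
    mittagLefflerKernel α r β t = t ^ (β - 1) * mittagLeffler α β (r * t ^ α) := by
  simp only [mittagLefflerKernel, mittagLeffler, mittagLefflerKernel_term_eq ht, tsum_mul_left]

theorem summable_mittagLefflerKernel {α t : ℝ} (hα : 1 < α) (ht : 0 < t) (r β : ℝ) :
    Summable fun k : ℕ ↦ r ^ k * t ^ (α * k + β - 1) / Real.Gamma (α * k + β) := by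
  simp only [mittagLefflerKernel_term_eq ht]
  exact (summable_pow_div_Gamma hα _ _).mul_left _

theorem sub_one_div_Gamma (x : ℝ) : (x - 1) / Real.Gamma x = 1 / Real.Gamma (x - 1) := by
  rcases eq_or_ne x 1 with rfl | hx
  · simp
  · have hx' : x - 1 ≠ 0 := sub_ne_zero.2 hx
    have h := Real.Gamma_add_one hx'
    rw [sub_add_cancel] at h
    rw [h, div_mul_eq_div_div, div_self hx']

theorem hasDerivAt_mittagLefflerKernel {α t : ℝ} (hα : 1 < α) (ht : 0 < t) (r β : ℝ) :
    HasDerivAt (mittagLefflerKernel α r β) (mittagLefflerKernel α r (β - 1) t) t := by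
  have hbound := (summable_mittagLefflerKernel hα (half_pos ht) r (β - 1)).norm.add
    (summable_mittagLefflerKernel hα (by linarith : 0 < 2 * t) r (β - 1)).norm
  have hmem : t ∈ Ioo (t / 2) (2 * t) := ⟨by linarith, by linarith⟩
  refine hasDerivAt_tsum_of_isPreconnected
    (g := fun (k : ℕ) s ↦ r ^ k * s ^ (α * k + β - 1) / Real.Gamma (α * k + β))
    (g' := fun (k : ℕ) s ↦ r ^ k * s ^ (α * k + (β - 1) - 1) / Real.Gamma (α * k + (β - 1)))
    hbound isOpen_Ioo isPreconnected_Ioo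
    (fun k y hy ↦ ?_) (fun k y hy ↦ ?_) hmem (summable_mittagLefflerKernel hα ht r β) hmem
  · have hy0 : 0 < y := (half_pos ht).trans hy.1
    refine (((Real.hasDerivAt_rpow_const (p := α * k + β - 1) (.inl hy0.ne')).const_mul
      (r ^ k)).div_const (Real.Gamma (α * k + β))).congr_deriv ?_
    have h := sub_one_div_Gamma (α * k + β)
    rw [show α * k + (β - 1) = α * k + β - 1 by ring,
      div_eq_mul_one_div _ (Real.Gamma (α * k + β - 1)), ← h]
    ring
  · have hy0 : 0 < y := (half_pos ht).trans hy.1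
    have hpow : y ^ (α * k + (β - 1) - 1)
        ≤ (t / 2) ^ (α * k + (β - 1) - 1) + (2 * t) ^ (α * k + (β - 1) - 1) := by
      rcases le_total 0 (α * k + (β - 1) - 1) with hp | hp
      · have := Real.rpow_le_rpow hy0.le hy.2.le hp
        have : 0 ≤ (t / 2) ^ (α * k + (β - 1) - 1) := by positivity
        linarith
      · have := Real.rpow_le_rpow_of_nonpos (half_pos ht) hy.1.le hp
        have : 0 ≤ (2 * t) ^ (α * k + (β - 1) - 1) := by positivity
        linarith
    simp only [norm_div, norm_mul]
    rw [← add_div, ← mul_add]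
    gcongr
    rwa [Real.norm_of_nonneg (by positivity), Real.norm_of_nonneg (by positivity),
      Real.norm_of_nonneg (by positivity)]

theorem mittagLefflerKernel_eq_add {α t : ℝ} (hα : 1 < α) (ht : 0 < t) (r β : ℝ) :
    mittagLefflerKernel α r β t
      = t ^ (β - 1) / Real.Gamma β + r * mittagLefflerKernel α r (β + α) t := by
  rw [mittagLefflerKernel, (summable_mittagLefflerKernel hα ht r β).tsum_eq_zero_add,
    mittagLefflerKernel, ← tsum_mul_left]
  congr 1
  · simp
  · refine tsum_congr fun k ↦ ?_
    rw [show α * ((k + 1 : ℕ) : ℝ) + β = α * k + (β + α) by push_cast; ring]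
    ring

theorem integral_rpow_mul_sub_rpow {a b t : ℝ} (ha : 0 < a) (hb : 0 < b) (ht : 0 < t) :
    ∫ s in (0 : ℝ)..t, s ^ (a - 1) * (t - s) ^ (b - 1)
      = t ^ (a + b - 1) * (Real.Gamma a * Real.Gamma b / Real.Gamma (a + b)) := by
  have hbeta : Complex.betaIntegral a b
      = ((Real.Gamma a * Real.Gamma b / Real.Gamma (a + b) : ℝ) : ℂ) := by
    have h := Complex.Gamma_mul_Gamma_eq_betaIntegral (s := a) (t := b) (by simpa) (by simpa)
    rw [← Complex.ofReal_add, Complex.Gamma_ofReal, Complex.Gamma_ofReal,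
      Complex.Gamma_ofReal] at h
    have hne : (Real.Gamma (a + b) : ℂ) ≠ 0 :=
      Complex.ofReal_ne_zero.2 (Real.Gamma_pos_of_pos (by positivity)).ne'
    push_cast
    rw [h, mul_div_cancel_left₀ _ hne]
  have h := Complex.betaIntegral_scaled a b ht
  rw [hbeta] at h
  apply Complex.ofReal_injective
  rw [← intervalIntegral.integral_ofReal, Complex.ofReal_mul, Complex.ofReal_cpow ht.le]
  push_cast at h ⊢
  rw [← h]
  refine intervalIntegral.integral_congr fun s hs ↦ ?_
  rw [uIcc_of_le ht.le] at hs
  rw [Complex.ofReal_cpow hs.1, Complex.ofReal_cpow (sub_nonneg.2 hs.2)]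
  push_cast
  rfl

theorem intervalIntegrable_rpow_mul_sub_rpow {a b t : ℝ} (ha : 0 < a) (hb : 0 < b) (ht : 0 < t) :
    IntervalIntegrable (fun s ↦ s ^ (a - 1) * (t - s) ^ (b - 1)) volume 0 t := by
  apply intervalIntegral.intervalIntegrable_of_integral_ne_zero
  rw [integral_rpow_mul_sub_rpow ha hb ht]
  have := Real.Gamma_pos_of_pos ha
  have := Real.Gamma_pos_of_pos hb
  have := Real.Gamma_pos_of_pos (add_pos ha hb)
  positivity

theorem intervalIntegrable_mittagLefflerKernel_mul {α β γ t : ℝ} (hα : 1 < α) (hβ : 0 < β)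
    (hγ : 0 < γ) (ht : 0 < t) (r : ℝ) :
    IntervalIntegrable (fun s ↦ mittagLefflerKernel α r β s * (t - s) ^ (γ - 1)) volume 0 t := by
  have hcont : Continuous fun s : ℝ ↦ mittagLeffler α β (r * s ^ α) :=
    (continuous_mittagLeffler hα).comp
      (continuous_const.mul (Real.continuous_rpow_const (by linarith)))
  refine ((intervalIntegrable_rpow_mul_sub_rpow hβ hγ ht).mul_continuousOn
    hcont.continuousOn).congr fun s hs ↦ ?_
  rw [uIoc_of_le ht.le] at hs
  simp only [mittagLefflerKernel_eq hs.1]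
  ring

theorem integral_mittagLefflerKernel_mul {α β γ t : ℝ} (hα : 1 < α) (hβ : 0 < β)
    (hγ : 0 < γ) (ht : 0 < t) (r : ℝ) :
    ∫ s in (0 : ℝ)..t, mittagLefflerKernel α r β s * (t - s) ^ (γ - 1)
      = Real.Gamma γ * mittagLefflerKernel α r (β + γ) t := by
  let F : ℝ → ℕ → ℝ → ℝ := fun ρ k s ↦
    ρ ^ k / Real.Gamma (α * k + β) * (s ^ (α * k + β - 1) * (t - s) ^ (γ - 1))
  have hpos (k : ℕ) : 0 < α * k + β := by positivity
  have hF (ρ : ℝ) (k : ℕ) : ∫ s in Ioc 0 t, F ρ k s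
      = Real.Gamma γ * (ρ ^ k * t ^ (α * k + (β + γ) - 1) / Real.Gamma (α * k + (β + γ))) := by
    have := (Real.Gamma_pos_of_pos (hpos k)).ne'
    simp only [F]
    rw [integral_const_mul, ← intervalIntegral.integral_of_le ht.le,
      integral_rpow_mul_sub_rpow (hpos k) hγ ht, add_assoc]
    field_simp
  have hnorm (k : ℕ) : ∫ s in Ioc 0 t, ‖F r k s‖ = ∫ s in Ioc 0 t, F |r| k s := by
    refine setIntegral_congr_fun measurableSet_Ioc fun s hs ↦ ?_
    have h1 := Real.rpow_nonneg hs.1.le (α * k + β - 1)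
    have h2 := Real.rpow_nonneg (sub_nonneg.2 hs.2) (γ - 1)
    simp only [F, norm_mul, norm_div, norm_pow, Real.norm_of_nonneg h1, Real.norm_of_nonneg h2,
      Real.norm_of_nonneg (Real.Gamma_pos_of_pos (hpos k)).le, Real.norm_eq_abs r]
  have hsum := hasSum_integral_of_summable_integral_norm (F := F r)
    (μ := volume.restrict (Ioc 0 t))
    (fun k ↦ ((intervalIntegrable_iff_integrableOn_Ioc_of_le ht.le).1
      (intervalIntegrable_rpow_mul_sub_rpow (hpos k) hγ ht)).const_mul _)
    (by
      simp only [hnorm, hF]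
      exact (summable_mittagLefflerKernel hα ht _ _).mul_left _)
  simp only [hF] at hsum
  rw [mittagLefflerKernel, ← tsum_mul_left, hsum.tsum_eq,
    intervalIntegral.integral_of_le ht.le]
  refine setIntegral_congr_fun measurableSet_Ioc fun s _ ↦ ?_
  simp only [mittagLefflerKernel, F, ← tsum_mul_right]
  refine tsum_congr fun k ↦ ?_
  ring

end

/-- For `1 < α < 2`, `μ > 0`, the function
`u t = (u₀ - c) E_{α,1}(-μ t^α) + c + u₁ t E_{α,2}(-μ t^α)` satisfies `u 0 = u₀`,
`u′(0) = u₁` (from the right), is twice differentiable on `(0,∞)`, and its Caputo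
fractional derivative of order `α` satisfies
`(1/Γ(2-α)) ∫₀ᵗ u″(s)(t-s)^(1-α) ds = -μ (u t - c)` for every `t > 0`. -/
theorem mittagLeffler_solves_fractional_flow_order_between_one_two
    (α μ c u₀ u₁ : ℝ) (hα1 : 1 < α) (hα2 : α < 2) (hμ : 0 < μ)
    (u : ℝ → ℝ)
    (hu : ∀ t : ℝ, u t = (u₀ - c) * mittagLeffler α 1 (-μ * t ^ α) + c
        + u₁ * t * mittagLeffler α 2 (-μ * t ^ α)) :
    u 0 = u₀ ∧
    HasDerivWithinAt u u₁ (Set.Ici 0) 0 ∧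
    (∀ t ∈ Set.Ioi (0:ℝ), DifferentiableAt ℝ u t ∧ DifferentiableAt ℝ (deriv u) t) ∧
    ∀ t : ℝ, 0 < t →
      (1 / Real.Gamma (2 - α)) * ∫ s in (0:ℝ)..t, deriv (deriv u) s * (t - s) ^ (1 - α)
        = -μ * (u t - c) := by
  have hα0 : 0 < α := by linarith
  have hcont1 : Continuous fun t : ℝ ↦ mittagLeffler α 1 (-μ * t ^ α) :=
    (continuous_mittagLeffler hα1).comp
      (continuous_const.mul (Real.continuous_rpow_const hα0.le))
  have hcont2 : Continuous fun t : ℝ ↦ mittagLeffler α 2 (-μ * t ^ α) :=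
    (continuous_mittagLeffler hα1).comp
      (continuous_const.mul (Real.continuous_rpow_const hα0.le))
  have hcontα : Continuous fun t : ℝ ↦ mittagLeffler α α (-μ * t ^ α) :=
    (continuous_mittagLeffler hα1).comp
      (continuous_const.mul (Real.continuous_rpow_const hα0.le))
  have hcont_u : Continuous u := by
    rw [funext hu]
    fun_prop
  have hu0 : u 0 = u₀ := by
    simp [hu, Real.zero_rpow hα0.ne', mittagLeffler_one_zero]
  let K := mittagLefflerKernel α (-μ)
  have hu_kernel {t : ℝ} (ht : 0 < t) : u t = (u₀ - c) * K 1 t + c + u₁ * K 2 t := by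
    simp only [K, mittagLefflerKernel_eq ht, hu]
    norm_num
    ring
  have hK {t : ℝ} (ht : 0 < t) (β : ℝ) : HasDerivAt (K β) (K (β - 1) t) t :=
    hasDerivAt_mittagLefflerKernel hα1 ht (-μ) β
  have hu' {t : ℝ} (ht : 0 < t) : HasDerivAt u ((u₀ - c) * K 0 t + u₁ * K 1 t) t := by
    have h := (((hK ht 1).const_mul (u₀ - c)).add_const c).add ((hK ht 2).const_mul u₁)
    norm_num at h
    refine h.congr_of_eventuallyEq ?_
    filter_upwards [Ioi_mem_nhds ht] with s hs using hu_kernel hs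
  have hu'' {t : ℝ} (ht : 0 < t) :
      HasDerivAt (deriv u) ((u₀ - c) * K (-1) t + u₁ * K 0 t) t := by
    have h := ((hK ht 0).const_mul (u₀ - c)).add ((hK ht 1).const_mul u₁)
    norm_num at h
    refine h.congr_of_eventuallyEq ?_
    filter_upwards [Ioi_mem_nhds ht] with s hs using (hu' hs).deriv
  have hK0 {t : ℝ} (ht : 0 < t) : K 0 t = -μ * K α t := by
    simpa using mittagLefflerKernel_eq_add hα1 ht (-μ) 0
  have hKneg {t : ℝ} (ht : 0 < t) : K (-1) t = -μ * K (α - 1) t := by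
    have h := mittagLefflerKernel_eq_add hα1 ht (-μ) (-1)
    have hG : Real.Gamma (-1) = 0 := by simpa using Real.Gamma_neg_nat_eq_zero 1
    rwa [hG, div_zero, zero_add, neg_add_eq_sub] at h
  refine ⟨hu0, ?_, fun t ht ↦ ⟨(hu' ht).differentiableAt, (hu'' ht).differentiableAt⟩, ?_⟩
  · refine hasDerivWithinAt_Ici_of_tendsto_deriv (s := Set.Ioi 0)
      (fun t ht ↦ (hu' ht).differentiableAt.differentiableWithinAt)
      hcont_u.continuousWithinAt self_mem_nhdsWithin ?_
    have hcont : Continuous fun t : ℝ ↦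
        (u₀ - c) * (-μ * (t ^ (α - 1) * mittagLeffler α α (-μ * t ^ α)))
          + u₁ * mittagLeffler α 1 (-μ * t ^ α) := by
      have := Real.continuous_rpow_const (q := α - 1) (by linarith)
      fun_prop
    have hlim := (hcont.tendsto 0).mono_left (nhdsWithin_le_nhds (s := Set.Ioi 0))
    simp only [Real.zero_rpow hα0.ne', Real.zero_rpow (sub_pos.2 hα1).ne', mul_zero, zero_mul,
      mittagLeffler_one_zero, zero_add, mul_one] at hlim
    refine hlim.congr' ?_
    filter_upwards [self_mem_nhdsWithin] with t ht
    rw [(hu' ht).deriv, hK0 ht]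
    simp only [K, mittagLefflerKernel_eq ht, sub_self, Real.rpow_zero, one_mul]
  · intro t ht
    have hγ : 0 < 2 - α := by linarith
    have hΓ : Real.Gamma (2 - α) ≠ 0 := (Real.Gamma_pos_of_pos hγ).ne'
    have hα' : 0 < α - 1 := by linarith
    have hcongr : ∫ s in (0 : ℝ)..t, deriv (deriv u) s * (t - s) ^ (1 - α)
        = ∫ s in (0 : ℝ)..t, (-μ * (u₀ - c) * (K (α - 1) s * (t - s) ^ (2 - α - 1))
          + -μ * u₁ * (K α s * (t - s) ^ (2 - α - 1))) := by
      rw [intervalIntegral.integral_of_le ht.le, intervalIntegral.integral_of_le ht.le]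
      refine MeasureTheory.setIntegral_congr_fun measurableSet_Ioc fun s hs ↦ ?_
      simp only [(hu'' hs.1).deriv, hK0 hs.1, hKneg hs.1, show 2 - α - 1 = 1 - α by ring]
      ring
    rw [hcongr, intervalIntegral.integral_add
        ((intervalIntegrable_mittagLefflerKernel_mul hα1 hα' hγ ht (-μ)).const_mul _)
        ((intervalIntegrable_mittagLefflerKernel_mul hα1 hα0 hγ ht (-μ)).const_mul _),
      intervalIntegral.integral_const_mul, intervalIntegral.integral_const_mul,
      integral_mittagLefflerKernel_mul hα1 hα' hγ ht,
      integral_mittagLefflerKernel_mul hα1 hα0 hγ ht, hu_kernel ht,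
      show α - 1 + (2 - α) = 1 by ring, show α + (2 - α) = 2 by ring]
    simp only [K]
    field_simp
    ring
end
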